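/- arXiv:1402.4486 — 4 statements merged into one kernel-verified Lean document; each statement's English description precedes it below -/
import Mathlib

section
/- Let V be a complex inner product space and let A, C be skew-symmetric ℂ-linear endomorphisms of V. Then for all integers s ≥ 1 and k ≥ 0, the endomorphism i^s • (ad A)^k(C^{s−1}) is skew-symmetric. (This is the key step showing that any representation of sl(2,ℝ) by skew-symmetric operators extends to a representation of the real form hs(λ), spanned by the elements i^s·V^s_n, by skew-symmetric operators.) -/
open scoped InnerProductSpace

/-- If `A` and `C` are skew-symmetric endomorphisms of a complex inner product space, then
`i^s • (ad A)^k (C^(s-1))` is skew-symmetric for all `s ≥ 1` and `k ≥ 0`. -/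
theorem skew_symmetric_iterated_ad (V : Type*) [NormedAddCommGroup V] [InnerProductSpace ℂ V]
    (A C : V →ₗ[ℂ] V)
    (hA : ∀ u v : V, ⟪A u, v⟫_ℂ = -⟪u, A v⟫_ℂ)
    (hC : ∀ u v : V, ⟪C u, v⟫_ℂ = -⟪u, C v⟫_ℂ)
    (s : ℕ) (hs : 1 ≤ s) (k : ℕ) :
    ∀ u v : V,
      ⟪((Complex.I ^ s) • ((fun T : V →ₗ[ℂ] V => A ∘ₗ T - T ∘ₗ A)^[k] (C ^ (s - 1)))) u, v⟫_ℂ =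
        -⟪u, ((Complex.I ^ s) •
          ((fun T : V →ₗ[ℂ] V => A ∘ₗ T - T ∘ₗ A)^[k] (C ^ (s - 1)))) v⟫_ℂ := by
  obtain ⟨n, rfl⟩ : ∃ n, s = n + 1 := ⟨s - 1, by omega⟩
  simp only [Nat.add_sub_cancel]
  have hpow : ∀ m : ℕ, ∀ u v : V, ⟪(C ^ m) u, v⟫_ℂ = (-1) ^ m * ⟪u, (C ^ m) v⟫_ℂ := by
    intro m
    induction m with
    | zero => intro u v; simp
    | succ m ih =>
      intro u v
      have h1 : (C ^ (m + 1)) u = (C ^ m) (C u) := by rw [pow_succ]; rfl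
      have h2 : (C ^ (m + 1)) v = C ((C ^ m) v) := by rw [pow_succ']; rfl
      rw [h1, h2, ih, hC]
      ring
  have key : ∀ u v : V,
      ⟪((fun T : V →ₗ[ℂ] V => A ∘ₗ T - T ∘ₗ A)^[k] (C ^ n)) u, v⟫_ℂ =
        (-1) ^ n * ⟪u, ((fun T : V →ₗ[ℂ] V => A ∘ₗ T - T ∘ₗ A)^[k] (C ^ n)) v⟫_ℂ := by
    induction k with
    | zero => exact hpow n
    | succ k ih =>
      intro u v
      rw [Function.iterate_succ_apply']
      simp only [LinearMap.sub_apply, LinearMap.comp_apply, inner_sub_left, inner_sub_right]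
      rw [hA, ih, ih, hA]
      ring
  intro u v
  rw [LinearMap.smul_apply, LinearMap.smul_apply, inner_smul_left, inner_smul_right, key, map_pow,
    Complex.conj_I, neg_pow Complex.I]
  have h : ((-1 : ℂ)) ^ n * (-1) ^ n = 1 := by rw [← mul_pow]; simp
  generalize ⟪u, _⟫_ℂ = x
  rw [pow_succ (-1 : ℂ)]
  linear_combination (-(Complex.I ^ (n + 1) * x)) * h
end

section
/- Let λ ∈ ℝ with 0 < λ < 1 and define, for f, g : ℝ → ℂ smooth and compactly supported, B(f,g) = ∫_{ℝ²} f(x)·conj(g(y))·|x−y|^{λ−1} dx dy. Then each of the three operators L₋(f)(x) = −f'(x), L₀(f)(x) = (λ+1)·f(x) + 2x·f'(x), L₊(f)(x) = (λ+1)·x·f(x) + x²·f'(x) is skew-symmetric for this pairing: B(L f, g) + B(f, L g) = 0 for L ∈ {L₋, L₀, L₊} and all smooth compactly supported f, g. -/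
open MeasureTheory Real

noncomputable section

/-- The hermitian pairing `(f,g)_c = ∫∫ f(x)·conj(g(y))·|x−y|^(λ−1) dx dy` defining the
complementary series Hilbert space. -/
def pairing (lam : ℝ) (f g : ℝ → ℂ) : ℂ :=
  ∫ p : ℝ × ℝ, f p.1 * (starRingEnd ℂ) (g p.2) * ((|p.1 - p.2| ^ (lam - 1) : ℝ) : ℂ)

/-- The operator `L₋(f)(x) = −f′(x)`. -/
def Lm (f : ℝ → ℂ) : ℝ → ℂ := fun x => -deriv f x

/-- The operator `L₀(f)(x) = (λ+1)·f(x) + 2x·f′(x)`. -/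
def L0 (lam : ℝ) (f : ℝ → ℂ) : ℝ → ℂ := fun x => (lam + 1) • f x + (2 * x) • deriv f x

/-- The operator `L₊(f)(x) = (λ+1)·x·f(x) + x²·f′(x)`. -/
def Lp (lam : ℝ) (f : ℝ → ℂ) : ℝ → ℂ := fun x => ((lam + 1) * x) • f x + (x ^ 2) • deriv f x

open Filter Topology Set

/-- smooth compactly supported functions -/
def SC (f : ℝ → ℂ) : Prop := ContDiff ℝ (⊤ : ℕ∞) f ∧ HasCompactSupport f

/-- bilinear version of the integrand -/
def bker (lam : ℝ) (f g : ℝ → ℂ) (p : ℝ × ℝ) : ℂ :=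
  f p.1 * g p.2 * ((|p.1 - p.2| ^ (lam - 1) : ℝ) : ℂ)

/-- multiplication by the coordinate -/
def Xm (f : ℝ → ℂ) : ℝ → ℂ := fun x => (x : ℂ) * f x

lemma SC.deriv {f : ℝ → ℂ} (h : SC f) : SC (deriv f) := by
  refine ⟨?_, h.2.deriv⟩
  have := (contDiff_infty_iff_deriv (𝕜 := ℝ) (f := f)).1 h.1
  exact this.2

lemma SC.Xm {f : ℝ → ℂ} (h : SC f) : SC (Xm f) := by
  refine ⟨?_, h.2.mul_left⟩
  exact (Complex.ofRealCLM.contDiff).mul h.1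

lemma SC.conj {f : ℝ → ℂ} (h : SC f) : SC (fun x => (starRingEnd ℂ) (f x)) := by
  refine ⟨Complex.conjCLE.contDiff.comp h.1, ?_⟩
  exact h.2.comp_left (g := starRingEnd ℂ) (map_zero _)

lemma SC.hasDerivAt {f : ℝ → ℂ} (h : SC f) (x : ℝ) : HasDerivAt f (_root_.deriv f x) x :=
  (h.1.differentiable (by simp) x).hasDerivAt

lemma SC.add {f g : ℝ → ℂ} (h : SC f) (h' : SC g) : SC (fun x => f x + g x) :=
  ⟨h.1.add h'.1, h.2.add h'.2⟩

lemma hasDerivAt_Xm {f : ℝ → ℂ} (h : SC f) (x : ℝ) :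
    HasDerivAt (Xm f) (f x + Xm (deriv f) x) x := by
  have := (Complex.ofRealCLM.hasDerivAt (x := x)).mul (h.hasDerivAt x)
  simpa [Xm] using! this

lemma deriv_Xm {f : ℝ → ℂ} (h : SC f) : deriv (Xm f) = fun x => f x + Xm (deriv f) x :=
  funext fun x => (hasDerivAt_Xm h x).deriv

lemma deriv_conj {f : ℝ → ℂ} (h : SC f) :
    deriv (fun x => (starRingEnd ℂ) (f x)) = fun x => (starRingEnd ℂ) (deriv f x) :=
  funext fun x => by
    have := Complex.conjCLE.toContinuousLinearMap.hasFDerivAt.comp_hasDerivAt x (h.hasDerivAt x)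
    simpa using! this.deriv

lemma loc_int {lam : ℝ} (h0 : 0 < lam) :
    LocallyIntegrable (fun u : ℝ => ((|u| ^ (lam - 1) : ℝ) : ℂ)) := by
  refine locallyIntegrable_of_norm_le_rpow (C := 1) (α := 1 - lam) (by simp) (by simp [h0]) ?_ ?_
  · filter_upwards with x
    simp [abs_of_nonneg (Real.rpow_nonneg (abs_nonneg x) _)]
  · have : Measurable (fun u : ℝ => ((|u| ^ (lam - 1) : ℝ) : ℂ)) := by fun_prop
    exact this.aestronglyMeasurable

lemma ker_int {lam : ℝ} (h0 : 0 < lam) {f g : ℝ → ℂ} (hf : SC f) (hg : SC g) :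
    Integrable (bker lam f g) := by
  obtain ⟨R, hR, hfR⟩ := hf.2.exists_pos_le_norm
  obtain ⟨R', hR', hgR⟩ := hg.2.exists_pos_le_norm
  set k : ℝ → ℂ := indicator (Icc (-(R + R')) (R + R'))
    (fun u : ℝ => ((|u| ^ (lam - 1) : ℝ) : ℂ)) with hk
  have kint : Integrable k := by
    rw [hk, integrable_indicator_iff measurableSet_Icc]
    exact (loc_int h0).integrableOn_isCompact isCompact_Icc
  have gint : Integrable g := hg.1.continuous.integrable_of_hasCompactSupport hg.2
  have h1 := gint.convolution_integrand (ContinuousLinearMap.mul ℝ ℂ) kint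
  obtain ⟨C, hC⟩ := hf.1.continuous.bounded_above_of_compact_support hf.2
  have h2 := h1.bdd_mul (f := fun p : ℝ × ℝ => f p.1) (c := C)
    (hf.1.continuous.comp continuous_fst).aestronglyMeasurable (ae_of_all _ fun p => hC _)
  refine h2.congr (ae_of_all _ fun p => ?_)
  simp only [bker, ContinuousLinearMap.mul_apply']
  by_cases hfp : R ≤ ‖p.1‖
  · simp [hfR _ hfp]
  by_cases hgp : R' ≤ ‖p.2‖
  · simp [hgR _ hgp]
  push Not at hfp hgp
  rw [Real.norm_eq_abs, abs_lt] at hfp hgp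
  rw [hk, indicator_of_mem, mul_assoc]
  constructor <;> linarith

lemma ev_top {f : ℝ → ℂ} (hf : SC f) : ∀ᶠ x in atTop, f x = 0 := by
  obtain ⟨R, hR, hfR⟩ := hf.2.exists_pos_le_norm
  filter_upwards [eventually_ge_atTop R] with x hx
  exact hfR x (hx.trans (le_abs_self x))

lemma ev_bot {f : ℝ → ℂ} (hf : SC f) : ∀ᶠ x in atBot, f x = 0 := by
  obtain ⟨R, hR, hfR⟩ := hf.2.exists_pos_le_norm
  filter_upwards [eventually_le_atBot (-R)] with x hx
  refine hfR x ?_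
  rw [Real.norm_eq_abs]
  exact le_trans (by linarith) (neg_le_abs x)

lemma A {lam : ℝ} (h0 : 0 < lam) {f g : ℝ → ℂ} (hf : SC f) (hg : SC g) :
    (∫ p, bker lam (deriv f) g p) + ∫ p, bker lam f (deriv g) p = 0 := by
  have i1 := ker_int h0 hf.deriv hg
  have i2 := ker_int h0 hf hg.deriv
  rw [← integral_add i1 i2]
  set W : ℝ × ℝ → ℂ := fun p => bker lam (deriv f) g p + bker lam f (deriv g) p with hW
  have iW : Integrable W := i1.add i2
  have mp : MeasurePreserving (fun z : ℝ × ℝ => (z.1 + z.2, z.2)) volume volume :=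
    measurePreserving_add_prod volume volume
  have iW' := mp.integrable_comp_of_integrable iW
  have e : ∫ p, W p = ∫ p, (W ∘ (fun z : ℝ × ℝ => (z.1 + z.2, z.2))) p := by
    conv_lhs => rw [← mp.map_eq]
    rw [integral_map mp.measurable.aemeasurable]
    · rfl
    · rw [mp.map_eq]; exact iW.aestronglyMeasurable
  rw [e, Measure.volume_eq_prod, integral_prod _ iW']
  apply integral_eq_zero_of_ae
  filter_upwards [Integrable.prod_right_ae iW'] with u hu
  have hd : ∀ y, HasDerivAt (fun y => f (u + y) * g y * ((|u| ^ (lam - 1) : ℝ) : ℂ))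
      ((W ∘ (fun z : ℝ × ℝ => (z.1 + z.2, z.2))) (u, y)) y := by
    intro y
    have h1 : HasDerivAt (fun y => f (u + y)) (deriv f (u + y)) y :=
      (hf.hasDerivAt (u + y)).comp_const_add u y
    have := (h1.mul (hg.hasDerivAt y)).mul_const ((|u| ^ (lam - 1) : ℝ) : ℂ)
    convert! this using 1
    simp only [hW, bker, Function.comp, add_sub_cancel_right]
    ring
  have := integral_of_hasDerivAt_of_tendsto (m := 0) (n := 0) hd hu
    (tendsto_const_nhds.congr' ?_) (tendsto_const_nhds.congr' ?_)
  · simpa using this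
  · filter_upwards [ev_bot hg] with y hy
    simp [hy]
  · filter_upwards [ev_top hg] with y hy
    simp [hy]

lemma h_deriv {lam u : ℝ} (hu : u ≠ 0) :
    HasDerivAt (fun u : ℝ => u * |u| ^ (lam - 1)) (lam * |u| ^ (lam - 1)) u := by
  have h1 := (hasDerivAt_abs hu).rpow_const (p := lam - 1) (Or.inl (abs_ne_zero.2 hu))
  have h2 := (hasDerivAt_id u).mul h1
  convert! h2 using 1
  have h3 : |u| ^ (lam - 1) = |u| ^ (lam - 1 - 1) * |u| := by
    rw [Real.rpow_sub_one (abs_ne_zero.2 hu) (lam - 1)]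
    field_simp
  have h4 : u * (SignType.sign u : ℝ) = |u| := self_mul_sign u
  simp only [id]
  linear_combination (lam - 1) * h3 - (lam - 1) * |u| ^ (lam - 1 - 1) * h4

lemma h_cont {lam : ℝ} (h0 : 0 < lam) :
    ContinuousAt (fun u : ℝ => u * |u| ^ (lam - 1)) 0 := by
  rw [ContinuousAt, zero_mul]
  apply squeeze_zero_norm (a := fun u : ℝ => |u| ^ lam)
  · intro u
    by_cases hu : u = 0
    · simp [hu, h0.ne']
    · rw [norm_mul, Real.norm_eq_abs, Real.norm_eq_abs,
        abs_of_nonneg (Real.rpow_nonneg (abs_nonneg u) _),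
        Real.rpow_sub_one (abs_ne_zero.2 hu)]
      have := abs_ne_zero.2 hu
      field_simp
      exact le_rfl
  · have : ContinuousAt (fun u : ℝ => |u| ^ lam) 0 :=
      continuous_abs.continuousAt.rpow_const (Or.inr h0.le)
    simpa [ContinuousAt, Real.zero_rpow h0.ne'] using this

lemma Bl {lam : ℝ} (h0 : 0 < lam) {f g : ℝ → ℂ} (hf : SC f) (hg : SC g) :
    lam * (∫ p, bker lam f g p) + (∫ p, bker lam (Xm (deriv f)) g p)
      - ∫ p, bker lam (deriv f) (Xm g) p = 0 := by
  have i1 := (ker_int h0 hf hg).const_mul (lam : ℂ)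
  have i2 := ker_int h0 hf.deriv.Xm hg
  have i3 := ker_int h0 hf.deriv hg.Xm
  have i12 : Integrable (fun p => (lam : ℂ) * bker lam f g p + bker lam (Xm (deriv f)) g p) :=
    i1.add i2
  rw [← integral_const_mul, ← integral_add i1 i2, ← integral_sub i12 i3]
  set W : ℝ × ℝ → ℂ := fun p => (lam * bker lam f g p + bker lam (Xm (deriv f)) g p)
    - bker lam (deriv f) (Xm g) p with hW
  have iW : Integrable W := i12.sub i3
  change ∫ p, W p = 0
  rw [Measure.volume_eq_prod, integral_prod_symm _ iW]
  apply integral_eq_zero_of_ae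
  filter_upwards [Integrable.prod_left_ae iW] with y hy
  set F : ℝ → ℂ := fun x => (((x - y) * |x - y| ^ (lam - 1) : ℝ) : ℂ) * f x * g y with hF
  have hd : ∀ x, x ≠ y → HasDerivAt F (W (x, y)) x := by
    intro x hx
    have h1 := ((h_deriv (lam := lam) (sub_ne_zero.2 hx)).comp_sub_const x y).ofReal_comp
    have := (h1.mul (hf.hasDerivAt x)).mul_const (g y)
    convert! this using 1
    simp only [hW, bker, Xm]
    push_cast
    ring
  have hc : ContinuousAt F y := by
    have h1 : ContinuousAt (fun x : ℝ => (x - y) * |x - y| ^ (lam - 1)) y := by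
      have h2 : ContinuousAt (fun u : ℝ => u * |u| ^ (lam - 1)) (y - y) := by
        rw [sub_self]; exact h_cont h0
      exact h2.comp (f := fun x : ℝ => x - y) (by fun_prop)
    exact ((Complex.continuous_ofReal.continuousAt.comp h1).mul
      hf.1.continuous.continuousAt).mul continuousAt_const
  have a1 := integral_Ioi_of_hasDerivAt_of_tendsto (m := 0) hc.continuousWithinAt
    (fun x hx => hd x (ne_of_gt hx)) hy.integrableOn (tendsto_const_nhds.congr' (by
      filter_upwards [ev_top hf] with x hx
      simp [hF, hx]))
  have a2 := integral_Iic_of_hasDerivAt_of_tendsto (m := 0) hc.continuousWithinAt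
    (fun x hx => hd x (ne_of_lt hx)) hy.integrableOn (tendsto_const_nhds.congr' (by
      filter_upwards [ev_bot hf] with x hx
      simp [hF, hx]))
  rw [← intervalIntegral.integral_Iic_add_Ioi (b := y) hy.integrableOn hy.integrableOn, a1, a2]
  simp

lemma K_addl {lam : ℝ} (h0 : 0 < lam) {f f' g : ℝ → ℂ} (hf : SC f) (hf' : SC f') (hg : SC g) :
    ∫ p, bker lam (fun x => f x + f' x) g p = (∫ p, bker lam f g p) + ∫ p, bker lam f' g p := by
  rw [← integral_add (ker_int h0 hf hg) (ker_int h0 hf' hg)]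
  congr 1; ext p; simp only [bker]; ring

lemma K_addr {lam : ℝ} (h0 : 0 < lam) {f g g' : ℝ → ℂ} (hf : SC f) (hg : SC g) (hg' : SC g') :
    ∫ p, bker lam f (fun x => g x + g' x) p = (∫ p, bker lam f g p) + ∫ p, bker lam f g' p := by
  rw [← integral_add (ker_int h0 hf hg) (ker_int h0 hf hg')]
  congr 1; ext p; simp only [bker]; ring

lemma pair_split {lam : ℝ} (h0 : 0 < lam) {f g a b c d : ℝ → ℂ} (s t : ℂ) (ha : SC a) (hb : SC b)
    (hc : SC c) (hd : SC d)
    (h : ∀ x y, f x * (starRingEnd ℂ) (g y) = s * (a x * c y) + t * (b x * d y)) :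
    pairing lam f g = s * (∫ p, bker lam a c p) + t * ∫ p, bker lam b d p := by
  rw [← integral_const_mul, ← integral_const_mul,
    ← integral_add ((ker_int h0 ha hc).const_mul s) ((ker_int h0 hb hd).const_mul t)]
  unfold pairing
  congr 1; ext p; rw [h]; simp only [bker]; ring

/-- For `0 < λ < 1`, each of `L₋`, `L₀`, `L₊` is skew-symmetric with respect to the
complementary series pairing on smooth compactly supported functions. -/
theorem complementary_series_skew_symmetric (lam : ℝ) (h0 : 0 < lam) (h1 : lam < 1)
    (f g : ℝ → ℂ) (hf : ContDiff ℝ (⊤ : ℕ∞) f) (hfc : HasCompactSupport f)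
    (hg : ContDiff ℝ (⊤ : ℕ∞) g) (hgc : HasCompactSupport g) :
    pairing lam (Lm f) g + pairing lam f (Lm g) = 0 ∧
    pairing lam (L0 lam f) g + pairing lam f (L0 lam g) = 0 ∧
    pairing lam (Lp lam f) g + pairing lam f (Lp lam g) = 0 := by
  have hF : SC f := ⟨hf, hfc⟩
  have hG' : SC g := ⟨hg, hgc⟩
  have hG := hG'.conj
  have hdG := deriv_conj hG'
  set G : ℝ → ℂ := fun x => (starRingEnd ℂ) (g x) with hGdef
  have hdG' : ∀ y, (starRingEnd ℂ) (deriv g y) = deriv G y := fun y => by rw [hdG]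
  have hG1 : ∀ y, (starRingEnd ℂ) (g y) = G y := fun y => rfl
  refine ⟨?_, ?_, ?_⟩
  · rw [pair_split h0 (-1) 0 hF.deriv hF hG hG (fun x y => by simp [Lm, hG1]),
      pair_split h0 (-1) 0 hF hF hG.deriv hG (fun x y => by simp [Lm, hdG'])]
    linear_combination -A h0 hF hG
  · rw [pair_split h0 (lam + 1) 2 hF hF.deriv.Xm hG hG (fun x y => by
        simp [L0, hG1, Xm]; ring),
      pair_split h0 (lam + 1) 2 hF hF hG hG.deriv.Xm (fun x y => by
        simp [L0, hG1, hdG', Xm, Complex.conj_ofNat]; ring)]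
    have a := A h0 hF hG.Xm
    rw [deriv_Xm hG, K_addr h0 hF hG hG.deriv.Xm] at a
    linear_combination 2 * a + 2 * Bl h0 hF hG
  · rw [pair_split h0 (lam + 1) 1 hF.Xm hF.deriv.Xm.Xm hG hG (fun x y => by
        simp [_root_.Lp, hG1, Xm]; ring),
      pair_split h0 (lam + 1) 1 hF hF hG.Xm hG.deriv.Xm.Xm (fun x y => by
        simp [_root_.Lp, hG1, hdG', Xm]; ring)]
    have a := A h0 hF hG.Xm.Xm
    have e : deriv (Xm (Xm G)) = fun x => Xm G x + (Xm G x + Xm (Xm (deriv G)) x) := by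
      rw [deriv_Xm hG.Xm, deriv_Xm hG]
      ext x; simp only [Xm]; ring
    rw [e, K_addr h0 hF hG.Xm (hG.Xm.add hG.deriv.Xm.Xm),
      K_addr h0 hF hG.Xm hG.deriv.Xm.Xm] at a
    have b1 := Bl h0 hF.Xm hG
    have e2 : Xm (deriv (Xm f)) = fun x => Xm f x + Xm (Xm (deriv f)) x := by
      rw [deriv_Xm hF]
      ext x; simp only [Xm]; ring
    rw [e2, deriv_Xm hF, K_addl h0 hF.Xm hF.deriv.Xm.Xm hG, K_addl h0 hF hF.deriv.Xm hG.Xm] at b1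
    have b2 := Bl h0 hF hG.Xm
    linear_combination a + b1 + b2
end
end

section
/- For every μ ∈ ℂ, the following identity of ℂ-linear endomorphisms of the polynomial ring ℂ[x,y] holds: (1/4)•( (1/2)•B∘B + E∘F + F∘E − (1/2)•B'∘B' − E'∘F' − F'∘E' ) = (1/8)(μ² − 2μ − 3)•id, where B(f) = (μ+1)·f + 2(x·f_x + y·f_y), B'(f) = 2(x·f_y − y·f_x), E(f) = (μ+1)·x·f + (x²−y²)·f_x + 2xy·f_y, E'(f) = −(μ+1)·y·f + (x²−y²)·f_y − 2xy·f_x, F(f) = −f_x, F'(f) = −f_y. (This is the computation of the first Euclidean Casimir Ω₁^E = (1/4)((1/2)X₀² + X₊X₋ + X₋X₊ − (1/2)Y₀² − Y₊Y₋ − Y₋Y₊) in the complementary series representation of SL(2,ℂ).) -/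
noncomputable section
open MvPolynomial

/-- The polynomial ring `ℂ[x,y]`, with `x = X 0` and `y = X 1`. -/
abbrev P2 : Type := MvPolynomial (Fin 2) ℂ

/-- Formal partial derivative with respect to `x`. -/
def ddx : P2 →ₗ[ℂ] P2 := (pderiv (0 : Fin 2)).toLinearMap
/-- Formal partial derivative with respect to `y`. -/
def ddy : P2 →ₗ[ℂ] P2 := (pderiv (1 : Fin 2)).toLinearMap

/-- `B(f) = (μ+1)·f + 2(x·f_x + y·f_y)`, the image of `X₀`. -/
def Bop (μ : ℂ) : Module.End ℂ P2 :=
  (μ + 1) • (LinearMap.id : P2 →ₗ[ℂ] P2) +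
    (2 : ℂ) • (LinearMap.mulLeft ℂ (X 0 : P2) ∘ₗ ddx + LinearMap.mulLeft ℂ (X 1 : P2) ∘ₗ ddy)

/-- `B'(f) = 2(x·f_y − y·f_x)`, the image of `Y₀`. -/
def B'op : Module.End ℂ P2 :=
  (2 : ℂ) • (LinearMap.mulLeft ℂ (X 0 : P2) ∘ₗ ddy - LinearMap.mulLeft ℂ (X 1 : P2) ∘ₗ ddx)

/-- `E(f) = (μ+1)·x·f + (x²−y²)·f_x + 2xy·f_y`, the image of `X₊`. -/
def Eop (μ : ℂ) : Module.End ℂ P2 :=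
  (μ + 1) • LinearMap.mulLeft ℂ (X 0 : P2) +
    LinearMap.mulLeft ℂ ((X 0 : P2) ^ 2 - (X 1 : P2) ^ 2) ∘ₗ ddx +
    (2 : ℂ) • (LinearMap.mulLeft ℂ ((X 0 : P2) * (X 1 : P2)) ∘ₗ ddy)

/-- `E'(f) = −(μ+1)·y·f + (x²−y²)·f_y − 2xy·f_x`, the image of `Y₊`. -/
def E'op (μ : ℂ) : Module.End ℂ P2 :=
  (-(μ + 1)) • LinearMap.mulLeft ℂ (X 1 : P2) +
    LinearMap.mulLeft ℂ ((X 0 : P2) ^ 2 - (X 1 : P2) ^ 2) ∘ₗ ddy -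
    (2 : ℂ) • (LinearMap.mulLeft ℂ ((X 0 : P2) * (X 1 : P2)) ∘ₗ ddx)

/-- `F(f) = −f_x`, the image of `X₋`. -/
def Fop : Module.End ℂ P2 := -ddx

/-- `F'(f) = −f_y`, the image of `Y₋`. -/
def F'op : Module.End ℂ P2 := -ddy

/-- The first Euclidean Casimir
`Ω₁^E = (1/4)((1/2)X₀² + X₊X₋ + X₋X₊ − (1/2)Y₀² − Y₊Y₋ − Y₋Y₊)` acts in the complementary
series representation of `SL(2,ℂ)` as the scalar `(1/8)(μ² − 2μ − 3)`. -/
theorem euclidean_casimir_one (μ : ℂ) :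
    (1/4 : ℂ) • ((1/2 : ℂ) • (Bop μ ∘ₗ Bop μ) + Eop μ ∘ₗ Fop + Fop ∘ₗ Eop μ -
        (1/2 : ℂ) • (B'op ∘ₗ B'op) - E'op μ ∘ₗ F'op - F'op ∘ₗ E'op μ) =
      ((1/8 : ℂ) * (μ ^ 2 - 2 * μ - 3)) • (LinearMap.id : P2 →ₗ[ℂ] P2) := by
  apply LinearMap.ext
  intro f
  have hc : pderiv (0 : Fin 2) (pderiv (1 : Fin 2) f) = pderiv (1 : Fin 2) (pderiv (0 : Fin 2) f) := by
    have h : ⁅(pderiv (0 : Fin 2) : Derivation ℂ P2 P2), (pderiv (1 : Fin 2) : Derivation ℂ P2 P2)⁆ = 0 := by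
      apply MvPolynomial.derivation_ext
      intro i
      fin_cases i <;> simp [Derivation.commutator_apply, pderiv_X]
    have h2 := congrArg (fun D : Derivation ℂ P2 P2 => D f) h
    simp only [Derivation.commutator_apply, Derivation.coe_zero, Pi.zero_apply] at h2
    exact sub_eq_zero.mp h2
  have h01 : pderiv (0 : Fin 2) (X 1 : P2) = 0 := pderiv_X_of_ne (by decide)
  have h10 : pderiv (1 : Fin 2) (X 0 : P2) = 0 := pderiv_X_of_ne (by decide)
  have c2 : (C 2 : P2) = 2 := map_ofNat C 2
  have c3 : (C 3 : P2) = 3 := map_ofNat C 3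
  have d2 : ∀ i : Fin 2, pderiv i (2 : P2) = 0 := fun i => by rw [← c2, pderiv_C]
  have e2 : (C (1/2) : P2) * 2 = 1 := by rw [← c2, ← C_mul]; norm_num
  have e4 : (C (1/4) : P2) = C (1/2) * C (1/2) := by rw [← C_mul]; norm_num
  have e8 : (C (1/8) : P2) = C (1/2) * C (1/2) * C (1/2) := by rw [← C_mul, ← C_mul]; norm_num
  simp only [Bop, B'op, Eop, E'op, Fop, F'op, ddx, ddy, LinearMap.smul_apply, LinearMap.add_apply,
    LinearMap.sub_apply, LinearMap.neg_apply, LinearMap.comp_apply, LinearMap.id_apply,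
    LinearMap.mulLeft_apply, Derivation.coeFn_coe, map_add, map_sub, map_neg,
    Derivation.leibniz, Derivation.leibniz_pow, smul_eq_C_mul, pderiv_C, pderiv_X_self, h01, h10, hc,
    smul_eq_mul, nsmul_eq_mul, C_mul, C_pow, C_1, c2, c3, e4, e8, d2, Derivation.map_one_eq_zero]
  push_cast
  generalize (C (1/2) : P2) = h at *
  generalize pderiv (1 : Fin 2) (pderiv (0 : Fin 2) f) = fxy at *
  generalize pderiv (1 : Fin 2) (pderiv (1 : Fin 2) f) = fyy at *
  generalize pderiv (0 : Fin 2) (pderiv (0 : Fin 2) f) = fxx at *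
  generalize pderiv (0 : Fin 2) f = fx at *
  generalize pderiv (1 : Fin 2) f = fy at *
  generalize (C μ : P2) = m at *
  generalize (X 0 : P2) = x at *
  generalize (X 1 : P2) = y at *
  clear d2 hc h01 h10 c2 c3 e4 e8
  grind
end
end

section
/- For every μ ∈ ℂ, the following identity of ℂ-linear endomorphisms of the polynomial ring ℂ[x,y] holds: (1/4)•( B∘B' + E∘F' + F'∘E + E'∘F + F∘E' ) = 0, where B(f) = (μ+1)·f + 2(x·f_x + y·f_y), B'(f) = 2(x·f_y − y·f_x), E(f) = (μ+1)·x·f + (x²−y²)·f_x + 2xy·f_y, E'(f) = −(μ+1)·y·f + (x²−y²)·f_y − 2xy·f_x, F(f) = −f_x, F'(f) = −f_y. (This is the computation showing that the second Euclidean Casimir Ω₂^E = (1/4)(X₀Y₀ + X₊Y₋ + Y₋X₊ + Y₊X₋ + X₋Y₊) vanishes in the complementary series representation of SL(2,ℂ).) -/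
noncomputable section
open MvPolynomial

/-- The second Euclidean Casimir `Ω₂^E = (1/4)(X₀Y₀ + X₊Y₋ + Y₋X₊ + Y₊X₋ + X₋Y₊)` vanishes
in the complementary series representation of `SL(2,ℂ)`. -/
theorem euclidean_casimir_two (μ : ℂ) :
    (1/4 : ℂ) • (Bop μ ∘ₗ B'op + Eop μ ∘ₗ F'op + F'op ∘ₗ Eop μ + E'op μ ∘ₗ Fop +
        Fop ∘ₗ E'op μ) = 0 := by
  have hc : ∀ f : P2, pderiv (1 : Fin 2) (pderiv (0 : Fin 2) f) =
      pderiv (0 : Fin 2) (pderiv (1 : Fin 2) f) := by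
    intro f
    have h : ⁅(pderiv (1 : Fin 2) : Derivation ℂ P2 P2), (pderiv (0 : Fin 2) : Derivation ℂ P2 P2)⁆ = 0 := by
      apply MvPolynomial.derivation_ext
      intro i
      fin_cases i <;> simp [Derivation.commutator_apply, pderiv_X]
    have h2 := congrArg (fun D : Derivation ℂ P2 P2 => D f) h
    simpa [Derivation.commutator_apply, sub_eq_zero] using h2
  have h01 : pderiv (0 : Fin 2) (X 1 : P2) = 0 := pderiv_X_of_ne (by decide)
  have h10 : pderiv (1 : Fin 2) (X 0 : P2) = 0 := pderiv_X_of_ne (by decide)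
  have h2 : (C 2 : P2) = 2 := map_ofNat C 2
  apply LinearMap.ext
  intro f
  rw [LinearMap.smul_apply, LinearMap.zero_apply]
  apply smul_eq_zero_of_right
  simp only [Bop, B'op, Eop, E'op, Fop, F'op, ddx, ddy, LinearMap.add_apply, LinearMap.sub_apply,
    LinearMap.neg_apply, LinearMap.smul_apply, LinearMap.comp_apply, LinearMap.mulLeft_apply,
    LinearMap.id_apply, Derivation.coeFn_coe, map_add, map_sub,
    map_neg, Derivation.leibniz, Derivation.leibniz_pow, pderiv_X_self,
    h01, h10, hc, smul_eq_mul, MvPolynomial.smul_eq_C_mul, pderiv_C, nsmul_eq_mul]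
  simp only [h2]
  push_cast
  ring
end
end
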